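/- Let B be a connected graded k-bialgebra that is generated as an algebra by B₁, and let (f, g) be a truncated bialgebra 2-cocycle of degree ℓ on B. Then: (1) if r > 1, f_{≤r} = 0 and g_{<r} = 0, then g_r = 0; (2) if ℓ < 0 and f_{≤r} = 0, then g_{≤r} = 0; (3) if ℓ < 0 and f = 0, then g = 0. -/

import Mathlib

/-!
STATEMENT 7: Let B be a connected graded k-bialgebra generated as an algebra by B₁, and
let (f, g) be a truncated bialgebra 2-cocycle of degree ℓ on B.  Then: (1) if r > 1,
f_{≤r} = 0 and g_{<r} = 0, then g_r = 0; (2) if ℓ < 0 and f_{≤r} = 0, then g_{≤r} = 0;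
(3) if ℓ < 0 and f = 0, then g = 0.
-/

open TensorProduct

namespace Rigidity

noncomputable section

variable (k B : Type*) [Field k] [Ring B] [Bialgebra k B]

/-- The augmentation ideal `B⁺ = ker ε` of the bialgebra `B`. -/
def Bplus : Submodule k B := LinearMap.ker (Coalgebra.counit (R := k) (A := B))

/-- The subspace `B⁺ ⊗ B⁺` of `B ⊗ B`. -/
def BpBp : Submodule k (B ⊗[k] B) :=
  LinearMap.range (TensorProduct.map (Bplus k B).subtype (Bplus k B).subtype)

variable (ℬ : ℕ → Submodule k B)

/-- The degree-`n` component `(B ⊗ B)_n = ⊕_{i+j=n} B_i ⊗ B_j` of `B ⊗ B`. -/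
def tensorGrade (n : ℕ) : Submodule k (B ⊗[k] B) :=
  ⨆ (ij : ℕ × ℕ) (_ : ij.1 + ij.2 = n),
    LinearMap.range (TensorProduct.map (ℬ ij.1).subtype (ℬ ij.2).subtype)

/-- The grading of `B` reindexed by `ℤ` (with `⊥` in negative degrees). -/
def gradeZ (z : ℤ) : Submodule k B := if 0 ≤ z then ℬ z.toNat else ⊥

/-- The grading of `B ⊗ B` reindexed by `ℤ` (with `⊥` in negative degrees). -/
def tensorGradeZ (z : ℤ) : Submodule k (B ⊗[k] B) :=
  if 0 ≤ z then tensorGrade k B ℬ z.toNat else ⊥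

/-- `f : B ⊗ B → B` is homogeneous of degree `ℓ`. -/
def HomogF (ℓ : ℤ) (f : B ⊗[k] B →ₗ[k] B) : Prop :=
  ∀ (n : ℕ) (u : B ⊗[k] B), u ∈ tensorGrade k B ℬ n → f u ∈ gradeZ k B ℬ (n + ℓ)

/-- `g : B → B ⊗ B` is homogeneous of degree `ℓ`. -/
def HomogG (ℓ : ℤ) (g : B →ₗ[k] B ⊗[k] B) : Prop :=
  ∀ (n : ℕ) (x : B), x ∈ ℬ n → g x ∈ tensorGradeZ k B ℬ (n + ℓ)

/-- `s : B → B` is homogeneous of degree `ℓ`. -/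
def HomogE (ℓ : ℤ) (s : B →ₗ[k] B) : Prop :=
  ∀ (n : ℕ) (x : B), x ∈ ℬ n → s x ∈ gradeZ k B ℬ (n + ℓ)

/-- The comultiplication of the bialgebra `B ⊗ B`:
`a ⊗ b ↦ (a₍₁₎ ⊗ b₍₁₎) ⊗ (a₍₂₎ ⊗ b₍₂₎)`. -/
def comul2 : B ⊗[k] B →ₗ[k] (B ⊗[k] B) ⊗[k] (B ⊗[k] B) :=
  (TensorProduct.tensorTensorTensorComm k B B B B).toLinearMap ∘ₗ
    TensorProduct.map Coalgebra.comul Coalgebra.comul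

/-- `(f, g)` is a truncated bialgebra 2-cocycle of degree `ℓ` on the graded
bialgebra `B` (with grading `ℬ`).  Here `f : B⁺ ⊗ B⁺ → B⁺` and `g : B⁺ → B⁺ ⊗ B⁺`
are modelled as maps on `B ⊗ B` resp. `B` via the extensions
`f(1 ⊗ a) = f(a ⊗ 1) = 0` and `g(1) = 0`. -/
def IsTruncCocycle (ℓ : ℤ) (f : B ⊗[k] B →ₗ[k] B) (g : B →ₗ[k] B ⊗[k] B) : Prop :=
  (∀ a : B, f ((1 : B) ⊗ₜ[k] a) = 0) ∧ (∀ a : B, f (a ⊗ₜ[k] (1 : B)) = 0) ∧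
  (∀ u : B ⊗[k] B, f u ∈ Bplus k B) ∧
  g 1 = 0 ∧ (∀ x : B, g x ∈ BpBp k B) ∧
  HomogF k B ℬ ℓ f ∧ HomogG k B ℬ ℓ g ∧
  -- (i) the Hochschild cocycle condition:
  (∀ a b c : B, a ∈ Bplus k B → b ∈ Bplus k B → c ∈ Bplus k B →
    a * f (b ⊗ₜ[k] c) + f (a ⊗ₜ[k] (b * c)) = f ((a * b) ⊗ₜ[k] c) + f (a ⊗ₜ[k] b) * c) ∧
  -- (ii) the coalgebra cocycle condition:
  (∀ c : B, c ∈ Bplus k B →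
    LinearMap.lTensor B g (Coalgebra.comul c) + LinearMap.lTensor B Coalgebra.comul (g c)
      = TensorProduct.assoc k B B B (LinearMap.rTensor B Coalgebra.comul (g c))
        + TensorProduct.assoc k B B B (LinearMap.rTensor B g (Coalgebra.comul c))) ∧
  -- (iii) the compatibility condition:
  (∀ a b : B, a ∈ Bplus k B → b ∈ Bplus k B →
    TensorProduct.map f (LinearMap.mul' k B) (comul2 k B (a ⊗ₜ[k] b))
      + TensorProduct.map (LinearMap.mul' k B) f (comul2 k B (a ⊗ₜ[k] b))
      - Coalgebra.comul (f (a ⊗ₜ[k] b))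
      = -(Coalgebra.comul (R := k) a * g b) + g (a * b) - g a * Coalgebra.comul (R := k) b)


variable {k B ℬ}

theorem tensorGrade_le {n : ℕ} {S : Submodule k (B ⊗[k] B)}
    (h : ∀ i j, i + j = n → ∀ x ∈ ℬ i, ∀ y ∈ ℬ j, x ⊗ₜ[k] y ∈ S) :
    tensorGrade k B ℬ n ≤ S := by
  refine iSup₂_le fun ij hij => ?_
  rintro _ ⟨t, rfl⟩
  induction t with
  | zero => simp
  | tmul x y => exact h _ _ hij _ x.2 _ y.2
  | add s t hs ht => rw [map_add]; exact S.add_mem hs ht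

theorem tmul_mem_tensorGrade {i j : ℕ} {x y : B} (hx : x ∈ ℬ i) (hy : y ∈ ℬ j) :
    x ⊗ₜ[k] y ∈ tensorGrade k B ℬ (i + j) :=
  Submodule.mem_iSup_of_mem (i, j) <| Submodule.mem_iSup_of_mem rfl
    ⟨(⟨x, hx⟩ : ℬ i) ⊗ₜ[k] (⟨y, hy⟩ : ℬ j), rfl⟩

/-- A linear map that vanishes on `(x₁ ⊗ y₁) ⊗ (x₂ ⊗ y₂)` for homogeneous elements of total
degree `i + j` vanishes on the shuffled product of degree-`i` and degree-`j` tensors. -/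
theorem map_tensorTensorTensorComm_eq_zero {M : Type*} [AddCommGroup M] [Module k M]
    (F : (B ⊗[k] B) ⊗[k] (B ⊗[k] B) →ₗ[k] M) {i j : ℕ}
    (hF : ∀ i₁ i₂ j₁ j₂, i₁ + i₂ = i → j₁ + j₂ = j → ∀ x₁ ∈ ℬ i₁, ∀ x₂ ∈ ℬ i₂,
      ∀ y₁ ∈ ℬ j₁, ∀ y₂ ∈ ℬ j₂, F ((x₁ ⊗ₜ[k] y₁) ⊗ₜ[k] (x₂ ⊗ₜ[k] y₂)) = 0)
    {u v : B ⊗[k] B} (hu : u ∈ tensorGrade k B ℬ i) (hv : v ∈ tensorGrade k B ℬ j) :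
    F (TensorProduct.tensorTensorTensorComm k B B B B (u ⊗ₜ[k] v)) = 0 := by
  let G : B ⊗[k] B →ₗ[k] B ⊗[k] B →ₗ[k] M :=
    TensorProduct.curry (F ∘ₗ (TensorProduct.tensorTensorTensorComm k B B B B).toLinearMap)
  suffices tensorGrade k B ℬ i ≤ LinearMap.ker (G.flip v) from this hu
  refine tensorGrade_le fun i₁ i₂ hi x₁ hx₁ x₂ hx₂ => ?_
  suffices tensorGrade k B ℬ j ≤ LinearMap.ker (G (x₁ ⊗ₜ[k] x₂)) from this hv
  refine tensorGrade_le fun j₁ j₂ hj y₁ hy₁ y₂ hy₂ => ?_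
  simpa [G] using hF i₁ i₂ j₁ j₂ hi hj x₁ hx₁ x₂ hx₂ y₁ hy₁ y₂ hy₂

theorem iSup_pow_eq_top_of_adjoin_eq_top {A : Submodule k B}
    (hgen : Algebra.adjoin k (A : Set B) = ⊤) : ⨆ n : ℕ, A ^ n = ⊤ := by
  rw [eq_top_iff, ← Algebra.top_toSubmodule, ← hgen, Algebra.adjoin_eq_span, Submodule.span_le]
  intro x hx
  obtain ⟨n, hn⟩ : ∃ n : ℕ, x ∈ A ^ n := by
    induction hx using Submonoid.closure_induction with
    | mem x hx => exact ⟨1, by simpa using hx⟩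
    | one => exact ⟨0, by rw [pow_zero]; exact Submodule.one_le.mp le_rfl⟩
    | mul x y _ _ hx hy =>
      obtain ⟨m, hm⟩ := hx
      obtain ⟨n, hn⟩ := hy
      exact ⟨m + n, by rw [pow_add]; exact Submodule.mul_mem_mul hm hn⟩
  exact Submodule.mem_iSup_of_mem n hn

/-- Submodules of the members of an independent family that together span everything
are equal to those members. -/
theorem _root_.iSupIndep.eq_of_le_of_iSup_eq_top {ι α : Type*} [CompleteLattice α]
    [IsModularLattice α] {S T : ι → α} (hT : iSupIndep T) (hle : ∀ i, S i ≤ T i)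
    (hS : ⨆ i, S i = ⊤) (i : ι) : S i = T i := by
  refine le_antisymm (hle i) ?_
  have htop : S i ⊔ ⨆ (j) (_ : j ≠ i), S j = ⊤ := by
    rw [eq_top_iff, ← hS]
    refine iSup_le fun j => ?_
    rcases eq_or_ne j i with rfl | hj
    · exact le_sup_left
    · exact le_sup_of_le_right (le_iSup₂_of_le j hj le_rfl)
  have hbot : (⨆ (j) (_ : j ≠ i), S j) ⊓ T i = ⊥ := by
    rw [eq_bot_iff, inf_comm]
    exact (inf_le_inf_left _ (iSup₂_mono fun j _ => hle j)).trans (hT i).le_bot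
  have h := sup_inf_assoc_of_le (⨆ (j) (_ : j ≠ i), S j) (hle i)
  rw [htop, top_inf_eq, hbot, sup_bot_eq] at h
  exact h.le

theorem pow_grade_one_eq_grade (hinternal : DirectSum.IsInternal ℬ)
    (hmul : ∀ i j, ℬ i * ℬ j ≤ ℬ (i + j)) (hconn : ℬ 0 = (1 : Submodule k B))
    (hgen : Algebra.adjoin k (ℬ 1 : Set B) = ⊤) (n : ℕ) : ℬ 1 ^ n = ℬ n := by
  refine hinternal.submodule_iSupIndep.eq_of_le_of_iSup_eq_top (S := fun n => ℬ 1 ^ n)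
    (fun m => ?_) (iSup_pow_eq_top_of_adjoin_eq_top hgen) n
  induction m with
  | zero => rw [pow_zero, hconn]
  | succ m ih => rw [pow_succ]; exact (mul_le_mul_left ih _).trans (hmul m 1)

theorem eq_zero_of_mem_tensorGrade_zero (hconn : ℬ 0 = (1 : Submodule k B)) {u : B ⊗[k] B}
    (hu : u ∈ tensorGrade k B ℬ 0) (hu' : u ∈ BpBp k B) : u = 0 := by
  have hle : tensorGrade k B ℬ 0 ≤ Submodule.span k {(1 : B) ⊗ₜ[k] (1 : B)} := by
    refine tensorGrade_le fun i j hij x hx y hy => ?_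
    obtain ⟨rfl, rfl⟩ : i = 0 ∧ j = 0 := by omega
    rw [hconn, Submodule.mem_one] at hx hy
    obtain ⟨a, rfl⟩ := hx
    obtain ⟨b, rfl⟩ := hy
    refine Submodule.mem_span_singleton.mpr ⟨a * b, ?_⟩
    rw [Algebra.algebraMap_eq_smul_one, Algebra.algebraMap_eq_smul_one, TensorProduct.smul_tmul_smul]
  obtain ⟨c, rfl⟩ := Submodule.mem_span_singleton.mp (hle hu)
  let E : B ⊗[k] B →ₗ[k] k ⊗[k] k := TensorProduct.map Coalgebra.counit Coalgebra.counit
  have hE : BpBp k B ≤ LinearMap.ker E := by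
    rintro _ ⟨t, rfl⟩
    induction t with
    | zero => simp
    | tmul x y =>
      have hx : Coalgebra.counit (R := k) (x : B) = 0 := x.2
      simp [E, hx]
    | add s t hs ht => rw [map_add]; exact Submodule.add_mem _ hs ht
  have h : TensorProduct.lid k k (E (c • ((1 : B) ⊗ₜ[k] (1 : B)))) = 0 := by
    rw [LinearMap.mem_ker.mp (hE hu'), map_zero]
  have hc : c = 0 := by simpa [E] using h
  rw [hc, zero_smul]

namespace IsTruncCocycle

variable {ℓ : ℤ} {f : B ⊗[k] B →ₗ[k] B} {g : B →ₗ[k] B ⊗[k] B}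

/-- If `f` vanishes in degrees at most `i + j`, then `g` is a derivation along `Δ` on
products of elements of positive degrees `i` and `j`. -/
theorem map_mul_eq (hfg : IsTruncCocycle k B ℬ ℓ f g)
    (hcomul : ∀ (n : ℕ) (x : B), x ∈ ℬ n →
      Coalgebra.comul (R := k) x ∈ tensorGrade k B ℬ n)
    {i j : ℕ} (hf : ∀ n ≤ i + j, ∀ u ∈ tensorGrade k B ℬ n, f u = 0)
    {a b : B} (ha : a ∈ ℬ i) (hb : b ∈ ℬ j) (ha' : a ∈ Bplus k B) (hb' : b ∈ Bplus k B) :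
    g (a * b) = Coalgebra.comul (R := k) a * g b + g a * Coalgebra.comul (R := k) b := by
  obtain ⟨-, -, -, -, -, -, -, -, -, h⟩ := hfg
  have h₁ : TensorProduct.map f (LinearMap.mul' k B) (comul2 k B (a ⊗ₜ[k] b)) = 0 :=
    map_tensorTensorTensorComm_eq_zero _
      (fun i₁ i₂ j₁ j₂ hi hj x₁ hx₁ x₂ _ y₁ hy₁ y₂ _ => by
        rw [TensorProduct.map_tmul, hf _ (by omega) _ (tmul_mem_tensorGrade hx₁ hy₁),
          TensorProduct.zero_tmul]) (hcomul i a ha) (hcomul j b hb)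
  have h₂ : TensorProduct.map (LinearMap.mul' k B) f (comul2 k B (a ⊗ₜ[k] b)) = 0 :=
    map_tensorTensorTensorComm_eq_zero _
      (fun i₁ i₂ j₁ j₂ hi hj x₁ _ x₂ hx₂ y₁ _ y₂ hy₂ => by
        rw [TensorProduct.map_tmul, hf _ (by omega) _ (tmul_mem_tensorGrade hx₂ hy₂),
          TensorProduct.tmul_zero]) (hcomul i a ha) (hcomul j b hb)
  have h := h a b ha' hb'
  rw [h₁, h₂, hf _ le_rfl _ (tmul_mem_tensorGrade ha hb), map_zero, add_zero, sub_zero] at h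
  rw [eq_comm, ← sub_eq_zero, ← neg_eq_zero, h]
  abel

theorem g_eq_zero_of_lt (hfg : IsTruncCocycle k B ℬ ℓ f g)
    (hinternal : DirectSum.IsInternal ℬ) (hmul : ∀ i j, ℬ i * ℬ j ≤ ℬ (i + j))
    (hcomul : ∀ (n : ℕ) (x : B), x ∈ ℬ n →
      Coalgebra.comul (R := k) x ∈ tensorGrade k B ℬ n)
    (hcounit : ∀ (n : ℕ) (x : B), x ∈ ℬ (n + 1) → Coalgebra.counit (R := k) x = (0 : k))
    (hconn : ℬ 0 = (1 : Submodule k B)) (hgen : Algebra.adjoin k (ℬ 1 : Set B) = ⊤)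
    {r : ℕ} (hr : 1 < r) (hf : ∀ n ≤ r, ∀ u ∈ tensorGrade k B ℬ n, f u = 0)
    (hg : ∀ n < r, ∀ x ∈ ℬ n, g x = 0) {x : B} (hx : x ∈ ℬ r) : g x = 0 := by
  obtain ⟨s, rfl⟩ : ∃ s, r = s + 2 := ⟨r - 2, by omega⟩
  have hpow := pow_grade_one_eq_grade hinternal hmul hconn hgen
  rw [← hpow, pow_succ' _ (s + 1), hpow] at hx
  suffices ℬ 1 * ℬ (s + 1) ≤ LinearMap.ker g from this hx
  refine Submodule.mul_le.mpr fun a ha b hb => ?_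
  rw [LinearMap.mem_ker, hfg.map_mul_eq hcomul (fun n hn => hf n (by omega)) ha hb
    (hcounit 0 a ha) (hcounit s b hb), hg 1 (by omega) a ha, hg (s + 1) (by omega) b hb,
    mul_zero, zero_mul, add_zero]

theorem g_eq_zero_of_mem_grade_le_one (hfg : IsTruncCocycle k B ℬ ℓ f g)
    (hconn : ℬ 0 = (1 : Submodule k B)) (hℓ : ℓ < 0) {n : ℕ} (hn : n ≤ 1) {x : B}
    (hx : x ∈ ℬ n) : g x = 0 := by
  obtain ⟨-, -, -, -, hplus, -, hhom, -⟩ := hfg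
  have h := hhom n x hx
  unfold tensorGradeZ at h
  split_ifs at h with h0
  · rw [show ((n : ℤ) + ℓ).toNat = 0 by omega] at h
    exact eq_zero_of_mem_tensorGrade_zero hconn h (hplus x)
  · exact (Submodule.mem_bot k).mp h

end IsTruncCocycle

/-- let `B` be a connected graded bialgebra generated as an algebra by `B₁`
and let `(f, g)` be a truncated bialgebra 2-cocycle of degree `ℓ` on `B`.  Then:
(1) if `r > 1`, `f_{≤r} = 0` and `g_{<r} = 0`, then `g_r = 0`;
(2) if `ℓ < 0` and `f_{≤r} = 0`, then `g_{≤r} = 0`;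
(3) if `ℓ < 0` and `f = 0`, then `g = 0`.
(Vanishing of the degree-`n` component of a map is expressed as vanishing of the map on
the degree-`n` component of its domain.) -/
theorem stmt_7 (k B : Type*) [Field k] [CharZero k] [Ring B] [Bialgebra k B]
    (ℬ : ℕ → Submodule k B)
    -- `B = ⊕_n B_n` is a graded bialgebra:
    (hinternal : DirectSum.IsInternal ℬ)
    (hmul : ∀ i j, ℬ i * ℬ j ≤ ℬ (i + j))
    (hcomul : ∀ (n : ℕ) (x : B), x ∈ ℬ n →
      Coalgebra.comul (R := k) x ∈ tensorGrade k B ℬ n)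
    (hcounit : ∀ (n : ℕ) (x : B), x ∈ ℬ (n + 1) → Coalgebra.counit (R := k) x = (0 : k))
    -- `B` is connected, i.e. `B₀ = k·1`:
    (hconn : ℬ 0 = (1 : Submodule k B))
    -- `B` is generated as an algebra by `B₁`:
    (hgen : Algebra.adjoin k (ℬ 1 : Set B) = ⊤)
    (ℓ : ℤ) (f : B ⊗[k] B →ₗ[k] B) (g : B →ₗ[k] B ⊗[k] B)
    (hfg : IsTruncCocycle k B ℬ ℓ f g) :
    -- (1):
    (∀ r : ℕ, 1 < r →
      (∀ n ≤ r, ∀ u ∈ tensorGrade k B ℬ n, f u = 0) →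
      (∀ n < r, ∀ x ∈ ℬ n, g x = 0) →
      ∀ x ∈ ℬ r, g x = 0) ∧
    -- (2):
    (ℓ < 0 → ∀ r : ℕ,
      (∀ n ≤ r, ∀ u ∈ tensorGrade k B ℬ n, f u = 0) →
      ∀ n ≤ r, ∀ x ∈ ℬ n, g x = 0) ∧
    -- (3):
    (ℓ < 0 → f = 0 → g = 0) := by
  have h₁ : ∀ r : ℕ, 1 < r →
      (∀ n ≤ r, ∀ u ∈ tensorGrade k B ℬ n, f u = 0) →
      (∀ n < r, ∀ x ∈ ℬ n, g x = 0) → ∀ x ∈ ℬ r, g x = 0 := fun r hr hf hg x hx =>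
    hfg.g_eq_zero_of_lt hinternal hmul hcomul hcounit hconn hgen hr hf hg hx
  have h₂ : ℓ < 0 → ∀ r : ℕ,
      (∀ n ≤ r, ∀ u ∈ tensorGrade k B ℬ n, f u = 0) →
      ∀ n ≤ r, ∀ x ∈ ℬ n, g x = 0 := by
    intro hℓ r hf n
    induction n using Nat.strong_induction_on with
    | _ n ih =>
      intro hn x hx
      rcases le_or_gt n 1 with h | h
      · exact hfg.g_eq_zero_of_mem_grade_le_one hconn hℓ h hx
      · exact h₁ n h (fun m hm => hf m (hm.trans hn)) (fun m hm => ih m hm (hm.le.trans hn)) x hx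
  refine ⟨h₁, h₂, fun hℓ hf => ?_⟩
  rw [← LinearMap.ker_eq_top, eq_top_iff, ← hinternal.submodule_iSup_eq_top]
  exact iSup_le fun n x hx => h₂ hℓ n (fun _ _ u _ => by rw [hf, LinearMap.zero_apply]) n le_rfl x hx

end
end Rigidity
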